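/- arXiv:2506.12054 — 5 statements merged into one kernel-verified Lean document; each statement's English description precedes it below -/
import Mathlib

section
/- Let A and B be finite abstract simplicial complexes whose vertex sets are disjoint, and let A ⊕ B be their join. Then the reduced Euler characteristic is multiplicative: 1 − χ(A ⊕ B) = (1 − χ(A)) · (1 − χ(B)). -/
open Finset

variable {V : Type*} [DecidableEq V]

/-- A finite abstract simplicial complex: a finite collection of nonempty finite sets
closed under taking nonempty subsets. -/
def IsComplex (G : Finset (Finset V)) : Prop :=
  (∀ x ∈ G, x.Nonempty) ∧ ∀ x ∈ G, ∀ y : Finset V, y ⊆ x → y.Nonempty → y ∈ G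

/-- The vertex set of a complex: the union of its elements. -/
def vertexSet (G : Finset (Finset V)) : Finset V := G.sup id

/-- The join A ⊕ B = A ∪ B ∪ {a ∪ b : a ∈ A, b ∈ B}. -/
def simJoin (A B : Finset (Finset V)) : Finset (Finset V) :=
  A ∪ B ∪ (A ×ˢ B).image fun p => p.1 ∪ p.2

/-- The Euler characteristic χ(G) = Σ_{x ∈ G} (−1)^{|x|−1}. -/
def eulerChar (G : Finset (Finset V)) : ℤ :=
  ∑ x ∈ G, (-1 : ℤ) ^ (x.card - 1)

theorem eulerChar_simJoin (A B : Finset (Finset V)) (hA : IsComplex A) (hB : IsComplex B)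
    (hdisj : Disjoint (vertexSet A) (vertexSet B)) :
    1 - eulerChar (simJoin A B) = (1 - eulerChar A) * (1 - eulerChar B) := by
  have hd : ∀ a ∈ A, ∀ b ∈ B, Disjoint a b := fun a ha b hb =>
    hdisj.mono (Finset.le_sup (f := id) ha) (Finset.le_sup (f := id) hb)
  have hself : ∀ s : Finset V, s.Nonempty → ¬ Disjoint s s := by
    intro s hs h
    exact hs.ne_empty (by simpa using h)
  have h1 : Disjoint A B := by
    rw [Finset.disjoint_left]
    intro x hxA hxB
    exact hself x (hA.1 x hxA) (hd x hxA x hxB)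
  have h2 : Disjoint (A ∪ B) ((A ×ˢ B).image fun p => p.1 ∪ p.2) := by
    rw [Finset.disjoint_left]
    intro x hx hx'
    obtain ⟨⟨a, b⟩, hab, rfl⟩ := Finset.mem_image.1 hx'
    obtain ⟨ha, hb⟩ := Finset.mem_product.1 hab
    rcases Finset.mem_union.1 hx with h | h
    · exact hself b (hB.1 b hb) ((hd _ h b hb).mono_left Finset.subset_union_right)
    · exact hself a (hA.1 a ha) ((hd a ha _ h).mono_right Finset.subset_union_left)
  have hinj : Set.InjOn (fun p : Finset V × Finset V => p.1 ∪ p.2)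
      (↑(A ×ˢ B) : Set (Finset V × Finset V)) := by
    rintro ⟨a, b⟩ hab ⟨c, d⟩ hcd h
    obtain ⟨ha, hb⟩ := Finset.mem_product.1 (Finset.mem_coe.1 hab)
    obtain ⟨hc, hd'⟩ := Finset.mem_product.1 (Finset.mem_coe.1 hcd)
    have e1 := Finset.disjoint_left.1 (hd a ha d hd')
    have e2 := Finset.disjoint_left.1 (hd c hc b hb)
    have e3 := Finset.disjoint_left.1 (hd a ha b hb)
    have e4 := Finset.disjoint_left.1 (hd c hc d hd')
    have h' : ∀ v, (v ∈ a ∨ v ∈ b) ↔ (v ∈ c ∨ v ∈ d) := by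
      intro v
      simpa using Finset.ext_iff.1 h v
    refine Prod.ext (Finset.ext fun v => ?_) (Finset.ext fun v => ?_)
    all_goals
      have := h' v
      have := @e1 v
      have := @e2 v
      have := @e3 v
      have := @e4 v
      dsimp only
      tauto
  have h3 : ∑ x ∈ (A ×ˢ B).image (fun p => p.1 ∪ p.2), (-1 : ℤ) ^ (x.card - 1)
      = -(eulerChar A * eulerChar B) := by
    rw [Finset.sum_image hinj, eulerChar, eulerChar, Finset.sum_mul_sum,
      ← Finset.sum_product', ← Finset.sum_neg_distrib]
    refine Finset.sum_congr rfl ?_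
    rintro ⟨a, b⟩ hab
    obtain ⟨ha, hb⟩ := Finset.mem_product.1 hab
    have ca := (hA.1 a ha).card_pos
    have cb := (hB.1 b hb).card_pos
    dsimp only at *
    rw [Finset.card_union_of_disjoint (hd a ha b hb), ← pow_add,
      show a.card + b.card - 1 = (a.card - 1 + (b.card - 1)) + 1 by omega, pow_succ]
    ring
  have h4 : eulerChar (simJoin A B) =
      eulerChar A + eulerChar B + -(eulerChar A * eulerChar B) := by
    rw [← h3, eulerChar, simJoin, Finset.sum_union h2, Finset.sum_union h1]
    rfl
  rw [h4]
  ring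
end

section
/- Let G be a finite abstract simplicial complex with vertex set V. Then the derivative of the simplex generating function of G equals the sum over vertices of the simplex generating functions of the unit spheres: f_G'(t) = Σ_{v ∈ V} f_{S(v)}(t), as an identity of polynomials. -/
open Finset Polynomial

variable {V : Type*} [DecidableEq V]

/-- The unit sphere (link) of a vertex v: S(v) = {y ∈ G : v ∉ y and y ∪ {v} ∈ G}. -/
def link (G : Finset (Finset V)) (v : V) : Finset (Finset V) :=
  G.filter fun y => v ∉ y ∧ insert v y ∈ G

/-- The simplex generating function f_G(t) = 1 + Σ_{x ∈ G} t^{|x|}. -/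
noncomputable def genFun (G : Finset (Finset V)) : Polynomial ℤ :=
  1 + ∑ x ∈ G, (X : Polynomial ℤ) ^ x.card

lemma genFun_link_eq (G : Finset (Finset V)) (hG : IsComplex G) (v : V)
    (hv : v ∈ vertexSet G) :
    genFun (link G v) = ∑ x ∈ G with v ∈ x, (X : Polynomial ℤ) ^ (x.card - 1) := by
  obtain ⟨x₀, hx₀, hvx₀⟩ : ∃ x ∈ G, v ∈ x := by
    simpa [vertexSet, Finset.mem_sup] using hv
  have hsing : {v} ∈ G := hG.2 x₀ hx₀ {v} (by simpa using hvx₀) (by simp)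
  have hempty : ∅ ∉ link G v := by
    intro h
    have := hG.1 ∅ (Finset.mem_filter.1 h).1
    simp at this
  have h1 : genFun (link G v) = ∑ y ∈ insert ∅ (link G v), (X : Polynomial ℤ) ^ y.card := by
    rw [Finset.sum_insert hempty]
    simp [genFun]
  have hmem : ∀ y ∈ insert ∅ (link G v), v ∉ y ∧ insert v y ∈ G := by
    intro y hy
    rcases Finset.mem_insert.1 hy with rfl | hy
    · simpa using hsing
    · exact (Finset.mem_filter.1 hy).2
  rw [h1]
  refine Finset.sum_bij' (fun y _ => insert v y) (fun x _ => x.erase v) ?_ ?_ ?_ ?_ ?_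
  · intro y hy
    simpa using (hmem y hy).2
  · intro x hx
    obtain ⟨hxG, hvx⟩ := Finset.mem_filter.1 hx
    rcases (x.erase v).eq_empty_or_nonempty with h | h
    · simp [h]
    · refine Finset.mem_insert_of_mem (Finset.mem_filter.2 ⟨?_, by simp, ?_⟩)
      · exact hG.2 x hxG _ (Finset.erase_subset _ _) h
      · rwa [Finset.insert_erase hvx]
  · intro y hy
    exact Finset.erase_insert (hmem y hy).1
  · intro x hx
    exact Finset.insert_erase (Finset.mem_filter.1 hx).2
  · intro y hy
    simp [Finset.card_insert_of_notMem (hmem y hy).1]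

theorem derivative_genFun (G : Finset (Finset V)) (hG : IsComplex G) :
    derivative (genFun G) = ∑ v ∈ vertexSet G, genFun (link G v) := by
  rw [Finset.sum_congr rfl (fun v hv => genFun_link_eq G hG v hv)]
  have h2 : derivative (genFun G) = ∑ x ∈ G, ∑ v ∈ x, (X : Polynomial ℤ) ^ (x.card - 1) := by
    simp [genFun, derivative_X_pow]
  rw [h2]
  refine Finset.sum_comm' ?_
  intro x v
  simp only [Finset.mem_filter, vertexSet, Finset.mem_sup, id]
  constructor
  · rintro ⟨hx, hv⟩
    exact ⟨⟨hx, hv⟩, x, hx, hv⟩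
  · rintro ⟨h, -⟩
    exact h
end

section
/- Let G be a finite abstract simplicial complex with vertex set V. For v ∈ V define the curvature K(v) = Σ_{m=0}^{∞} (−1)^m · c_m(v)/(m+1), where c_0(v) = 1 and for m ≥ 1, c_m(v) is the number of simplices of cardinality m in the unit sphere S(v); equivalently K(v) = Σ_{x ∈ G, v ∈ x} (−1)^{|x|−1}/|x|. Then Gauss–Bonnet holds: Σ_{v ∈ V} K(v) = χ(G). -/
open Finset

variable {V : Type*} [DecidableEq V]

/-- The curvature K(v) = Σ_{m≥0} (−1)^m c_m(v)/(m+1), where c_0(v) = 1 and for m ≥ 1,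
c_m(v) is the number of simplices of cardinality m in the unit sphere S(v).
Each y ∈ S(v) of cardinality m contributes (−1)^m/(m+1). -/
def curvature (G : Finset (Finset V)) (v : V) : ℚ :=
  1 + ∑ y ∈ link G v, (-1 : ℚ) ^ y.card / (y.card + 1)

/-- The Euler characteristic χ(G) = Σ_{x ∈ G} (−1)^{|x|−1}, as a rational number. -/
def eulerCharQ (G : Finset (Finset V)) : ℚ :=
  ∑ x ∈ G, (-1 : ℚ) ^ (x.card - 1)

/-- The curvature as a sum over the simplices containing the vertex. -/
theorem curvature_eq_sum_star (G : Finset (Finset V)) (hG : IsComplex G) (v : V)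
    (hv : v ∈ vertexSet G) :
    curvature G v = ∑ x ∈ G.filter (fun x => v ∈ x), (-1 : ℚ) ^ (x.card - 1) / x.card := by
  obtain ⟨x, hx, hvx⟩ : ∃ x ∈ G, v ∈ x := by
    simpa [vertexSet, Finset.mem_sup] using hv
  have hs : ({v} : Finset V) ∈ G :=
    hG.2 x hx {v} (by simpa using hvx) (by simp)
  have hmem : ({v} : Finset V) ∈ G.filter (fun x => v ∈ x) := by simp [hs]
  rw [← Finset.add_sum_erase _ _ hmem]
  unfold curvature
  congr 1
  · simp
  · refine Finset.sum_bij' (fun y _ => insert v y) (fun x _ => x.erase v) ?_ ?_ ?_ ?_ ?_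
    · intro y hy
      simp only [link, mem_filter] at hy
      obtain ⟨hyG, hvy, hi⟩ := hy
      simp only [mem_erase, mem_filter, mem_insert_self, and_true]
      refine ⟨fun h => ?_, hi⟩
      obtain ⟨w, hw⟩ := hG.1 y hyG
      have hwv : w ∈ ({v} : Finset V) := h ▸ mem_insert_of_mem hw
      rw [mem_singleton] at hwv
      exact hvy (hwv ▸ hw)
    · intro z hz
      simp only [mem_erase, mem_filter] at hz
      obtain ⟨hne, hzG, hvz⟩ := hz
      simp only [link, mem_filter, insert_erase hvz, notMem_erase, not_false_eq_true, true_and]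
      refine ⟨hG.2 z hzG _ (erase_subset _ _) ?_, hzG⟩
      rw [nonempty_iff_ne_empty]
      intro h
      apply hne
      rw [← insert_erase hvz, h]
      rfl
    · intro y hy
      simp only [link, mem_filter] at hy
      exact erase_insert hy.2.1
    · intro z hz
      simp only [mem_erase, mem_filter] at hz
      exact insert_erase hz.2.2
    · intro y hy
      simp only [link, mem_filter] at hy
      rw [card_insert_of_notMem hy.2.1]
      simp

/-- Gauss–Bonnet: the sum of the curvatures over all vertices is the Euler characteristic.
Equivalently K(v) = Σ_{x ∈ G, v ∈ x} (−1)^{|x|−1}/|x|. -/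
theorem gaussBonnet (G : Finset (Finset V)) (hG : IsComplex G) :
    (∀ v ∈ vertexSet G,
      curvature G v = ∑ x ∈ G.filter (fun x => v ∈ x), (-1 : ℚ) ^ (x.card - 1) / x.card) ∧
    ∑ v ∈ vertexSet G, curvature G v = eulerCharQ G := by
  refine ⟨fun v hv => curvature_eq_sum_star G hG v hv, ?_⟩
  rw [Finset.sum_congr rfl (fun v hv => curvature_eq_sum_star G hG v hv)]
  unfold eulerCharQ
  rw [Finset.sum_comm' (t' := G) (s' := fun x => x)]
  · refine Finset.sum_congr rfl fun x hx => ?_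
    have hc : (x.card : ℚ) ≠ 0 := by
      exact_mod_cast (Finset.card_pos.mpr (hG.1 x hx)).ne'
    rw [Finset.sum_const, nsmul_eq_mul]
    field_simp
  · intro v x
    simp only [vertexSet, Finset.mem_sup, mem_filter, id]
    constructor
    · rintro ⟨_, hx, hv⟩
      exact ⟨hv, hx⟩
    · rintro ⟨hv, hx⟩
      exact ⟨⟨x, hx, hv⟩, hx, hv⟩
end

section
/- Let G be a finite abstract simplicial complex that is pure of dimension q ≥ 1 such that every element of G of cardinality q is contained in exactly two facets. Then for every facet x and every vertex a ∈ x there exists a unique vertex a' ≠ a such that (x ∖ {a}) ∪ {a'} is a facet; moreover the map sending the pointed facet (x, a) to the pointed facet ((x ∖ {a}) ∪ {a'}, a') is a fixed-point-free involution on the set of pairs (facet, base vertex of that facet). -/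
open Finset

variable {V : Type*} [DecidableEq V]

/-- G is pure of dimension q: every element is contained in an element of cardinality q+1
and every maximal element has cardinality q+1. -/
def IsPure (G : Finset (Finset V)) (q : ℕ) : Prop :=
  (∀ x ∈ G, ∃ y ∈ G, x ⊆ y ∧ y.card = q + 1) ∧
  (∀ x ∈ G, (∀ y ∈ G, x ⊆ y → y = x) → x.card = q + 1)

/-- The set of facets of G: the elements of cardinality q+1. -/
def facets (G : Finset (Finset V)) (q : ℕ) : Finset (Finset V) :=
  G.filter fun x => x.card = q + 1

/-- A pointed facet: a pair (x, a) of a facet x and a base vertex a ∈ x. -/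
def PointedFacets (G : Finset (Finset V)) (q : ℕ) : Set (Finset V × V) :=
  {p | p.1 ∈ facets G q ∧ p.2 ∈ p.1}

/-- If every simplex of cardinality q lies in exactly two facets, then for every facet x
and base vertex a ∈ x there is a unique vertex a' ≠ a with (x ∖ {a}) ∪ {a'} a facet;
moreover (x, a) ↦ ((x ∖ {a}) ∪ {a'}, a') is a fixed-point-free involution of the
set of pointed facets. -/
theorem pointed_facet_involution (G : Finset (Finset V)) (q : ℕ) (hq : 1 ≤ q)
    (hG : IsComplex G) (hpure : IsPure G q)
    (hwall : ∀ z ∈ G, z.card = q → (facets G q |>.filter fun x => z ⊆ x).card = 2) :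
    (∀ x ∈ facets G q, ∀ a ∈ x, ∃! a' : V, a' ≠ a ∧ insert a' (x.erase a) ∈ facets G q) ∧
    ∀ φ : Finset V × V → Finset V × V,
      (∀ x ∈ facets G q, ∀ a ∈ x, ∀ a' : V,
        a' ≠ a ∧ insert a' (x.erase a) ∈ facets G q →
          φ (x, a) = (insert a' (x.erase a), a')) →
      ∀ p ∈ PointedFacets G q, φ p ∈ PointedFacets G q ∧ φ (φ p) = p ∧ φ p ≠ p := by
  have key : ∀ x ∈ facets G q, ∀ a ∈ x,
      ∃! a' : V, a' ≠ a ∧ insert a' (x.erase a) ∈ facets G q := by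
    intro x hx a ha
    have hx' := hx
    simp only [facets, Finset.mem_filter] at hx'
    obtain ⟨hxG, hxc⟩ := hx'
    have hzc : (x.erase a).card = q := by
      rw [Finset.card_erase_of_mem ha, hxc]; rfl
    have hzG : x.erase a ∈ G := by
      apply hG.2 x hxG _ (Finset.erase_subset _ _)
      rw [← Finset.card_pos]; omega
    have h2 := hwall _ hzG hzc
    have hxm : x ∈ (facets G q).filter fun y => x.erase a ⊆ y :=
      Finset.mem_filter.2 ⟨hx, Finset.erase_subset _ _⟩
    have h1 : (((facets G q).filter fun y => x.erase a ⊆ y).erase x).card = 1 := by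
      rw [Finset.card_erase_of_mem hxm, h2]
    obtain ⟨y, hy⟩ := Finset.card_eq_one.1 h1
    have hyy : ∀ w, w ≠ x ∧ w ∈ facets G q ∧ x.erase a ⊆ w ↔ w = y := by
      intro w
      rw [← Finset.mem_singleton, ← hy, Finset.mem_erase, Finset.mem_filter]
    obtain ⟨hyx, hyf, hzy⟩ := (hyy y).2 rfl
    have hyc : y.card = q + 1 := (Finset.mem_filter.1 hyf).2
    have hd : (y \ x.erase a).card = 1 := by
      rw [Finset.card_sdiff_of_subset hzy]; omega
    obtain ⟨b, hb⟩ := Finset.card_eq_one.1 hd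
    have hby : insert b (x.erase a) = y := by
      rw [Finset.insert_eq, ← hb, Finset.sdiff_union_of_subset hzy]
    refine ⟨b, ⟨?_, hby ▸ hyf⟩, ?_⟩
    · rintro rfl
      exact hyx (by rw [← hby, Finset.insert_erase ha])
    · rintro c ⟨hca, hcf⟩
      have hcc : (insert c (x.erase a)).card = q + 1 := (Finset.mem_filter.1 hcf).2
      have hcz : c ∉ x.erase a := by
        intro h
        rw [Finset.insert_eq_of_mem h] at hcc
        omega
      have hcx : insert c (x.erase a) ≠ x := by
        intro h
        rw [← h] at ha
        simp [hca.symm] at ha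
      have hcy := (hyy _).1 ⟨hcx, hcf, Finset.subset_insert _ _⟩
      have : c ∈ y \ x.erase a :=
        Finset.mem_sdiff.2 ⟨hcy ▸ Finset.mem_insert_self _ _, hcz⟩
      rw [hb] at this
      exact Finset.mem_singleton.1 this
  refine ⟨key, ?_⟩
  rintro φ hφ ⟨x, a⟩ ⟨hx, ha⟩
  simp only at hx ha
  obtain ⟨b, ⟨hba, hbf⟩, -⟩ := key x hx a ha
  have h1 := hφ x hx a ha b ⟨hba, hbf⟩
  have hxc : x.card = q + 1 := (Finset.mem_filter.1 hx).2
  have hbc : (insert b (x.erase a)).card = q + 1 := (Finset.mem_filter.1 hbf).2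
  have hbz : b ∉ x.erase a := by
    intro h
    rw [Finset.insert_eq_of_mem h, Finset.card_erase_of_mem ha] at hbc
    omega
  have hback : insert a ((insert b (x.erase a)).erase b) = x := by
    rw [Finset.erase_insert hbz, Finset.insert_erase ha]
  have h2 := hφ _ hbf b (Finset.mem_insert_self _ _) a ⟨hba.symm, by rw [hback]; exact hx⟩
  rw [h1, h2, hback]
  refine ⟨⟨hbf, Finset.mem_insert_self _ _⟩, rfl, ?_⟩
  intro h
  exact hba (Prod.ext_iff.1 h).2
end

section
/- Let G be a finite abstract simplicial complex that is pure of dimension q ≥ 1 such that every element of G of cardinality q is contained in exactly two facets. Then the map T on the set P of frames that sends the frame (x_0, x_1, …, x_q) to the frame (x_1, …, x_q, x_0'), where x_0' is the unique vertex distinct from x_0 such that {x_1, …, x_q, x_0'} is a facet, is well defined and is a bijection of P. -/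
open Finset

variable {V : Type*} [DecidableEq V]

/-- The set P of frames: injective (q+1)-tuples of vertices whose underlying set
is a facet. -/
def Frames (G : Finset (Finset V)) (q : ℕ) : Set (Fin (q + 1) → V) :=
  {f | Function.Injective f ∧ Finset.image f Finset.univ ∈ facets G q}

theorem aux_unique {G : Finset (Finset V)} {q : ℕ}
    {z : Finset V} (hz : z.card = q)
    (h2 : ((facets G q).filter fun x => z ⊆ x).card = 2) {a b c : V}
    (ha : insert a z ∈ facets G q) (hb : insert b z ∈ facets G q)
    (hc : insert c z ∈ facets G q) (hba : b ≠ a) (hca : c ≠ a) : b = c := by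
  have key : ∀ u, insert u z ∈ facets G q → u ∉ z := by
    intro u hu hmem
    have := (Finset.mem_filter.1 hu).2
    rw [Finset.insert_eq_of_mem hmem] at this
    omega
  have inj : ∀ u v, insert u z ∈ facets G q → insert u z = insert v z → u = v := by
    intro u v hu huv
    have h1 : u ∈ insert v z := huv ▸ Finset.mem_insert_self u z
    rcases Finset.mem_insert.1 h1 with h | h
    · exact h
    · exact absurd h (key u hu)
  by_contra hbc
  have hsub : ({insert a z, insert b z, insert c z} : Finset (Finset V)) ⊆
      (facets G q).filter fun x => z ⊆ x := by
    intro x hx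
    simp only [Finset.mem_insert, Finset.mem_singleton] at hx
    rcases hx with rfl | rfl | rfl
    · exact Finset.mem_filter.2 ⟨ha, Finset.subset_insert _ _⟩
    · exact Finset.mem_filter.2 ⟨hb, Finset.subset_insert _ _⟩
    · exact Finset.mem_filter.2 ⟨hc, Finset.subset_insert _ _⟩
  have h3 := Finset.card_le_card hsub
  rw [Finset.card_eq_three.2 ⟨_, _, _, fun h => hba (inj _ _ ha h).symm,
    fun h => hca (inj _ _ ha h).symm, fun h => hbc (inj _ _ hb h), rfl⟩] at h3
  omega

theorem aux_image (q : ℕ) (f : Fin (q + 1) → V) :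
    Finset.image f Finset.univ =
      insert (f 0) (Finset.image (fun i : Fin q => f i.succ) Finset.univ) := by
  ext x
  simp [Fin.exists_fin_succ, eq_comm]

theorem aux_image_last (q : ℕ) (f : Fin (q + 1) → V) :
    Finset.image f Finset.univ =
      insert (f (Fin.last q)) (Finset.image (fun i : Fin q => f i.castSucc) Finset.univ) := by
  ext x
  simp [Fin.exists_fin_succ', eq_comm, or_comm]

theorem aux_frame {G : Finset (Finset V)} {q : ℕ} (hq : 1 ≤ q) (hG : IsComplex G)
    {f : Fin (q + 1) → V} (hf : f ∈ Frames G q) :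
    (Finset.image (fun i : Fin q => f i.succ) Finset.univ).card = q ∧
    Finset.image (fun i : Fin q => f i.succ) Finset.univ ∈ G ∧
    f 0 ∉ Finset.image (fun i : Fin q => f i.succ) Finset.univ := by
  have hc : (Finset.image (fun i : Fin q => f i.succ) Finset.univ).card = q := by
    have := Finset.card_image_of_injective Finset.univ (hf.1.comp (Fin.succ_injective q))
    simpa [Function.comp_def] using this
  refine ⟨hc, ?_, ?_⟩
  · refine hG.2 _ (Finset.mem_filter.1 hf.2).1 _ ?_ (Finset.card_pos.1 (by omega))
    rw [aux_image]
    exact Finset.subset_insert _ _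
  · intro h
    obtain ⟨i, -, hi⟩ := Finset.mem_image.1 h
    exact Fin.succ_ne_zero i (hf.1 hi)

/-- Suppose every simplex of cardinality q lies in exactly two facets.  Then (1): for
every frame (x_0, …, x_q) there is a unique vertex x_0' ≠ x_0 such that
{x_1, …, x_q, x_0'} is a facet, so the geodesic flow T, sending (x_0, x_1, …, x_q) to
(x_1, …, x_q, x_0'), is well defined; and (2): any map T of this shape that sends
frames to frames is a bijection of the set P of frames. -/
theorem geodesic_flow_bijective (G : Finset (Finset V)) (q : ℕ) (hq : 1 ≤ q)
    (hG : IsComplex G) (hpure : IsPure G q)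
    (hwall : ∀ z ∈ G, z.card = q → (facets G q |>.filter fun x => z ⊆ x).card = 2) :
    (∀ f ∈ Frames G q, ∃! a : V, a ≠ f 0 ∧
        insert a ((Finset.image f Finset.univ).erase (f 0)) ∈ facets G q) ∧
    ∀ T : (Fin (q + 1) → V) → (Fin (q + 1) → V),
      (∀ f ∈ Frames G q,
        (∀ i : Fin q, T f i.castSucc = f i.succ) ∧
        T f (Fin.last q) ≠ f 0 ∧
        T f ∈ Frames G q) →
      Set.BijOn T (Frames G q) (Frames G q) := by
  constructor
  · intro f hf
    obtain ⟨hc, hzG, h0⟩ := aux_frame hq hG hf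
    have hfac := hf.2
    rw [aux_image] at hfac ⊢
    rw [Finset.erase_insert h0]
    set z := Finset.image (fun i : Fin q => f i.succ) Finset.univ with hz
    have h2 := hwall z hzG hc
    obtain ⟨y, hy, hne⟩ := Finset.exists_mem_ne (by omega) (insert (f 0) z)
      (s := (facets G q).filter fun x => z ⊆ x)
    obtain ⟨hyf, hzy⟩ := Finset.mem_filter.1 hy
    have hyc := (Finset.mem_filter.1 hyf).2
    obtain ⟨a, ha, hay⟩ : ∃ a, a ∉ z ∧ insert a z = y := by
      have := Finset.exists_eq_insert_iff.2 ⟨hzy, by omega⟩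
      simpa using this
    refine ⟨a, ⟨?_, hay ▸ hyf⟩, ?_⟩
    · rintro rfl
      exact hne hay.symm
    · rintro b ⟨hb, hbf⟩
      refine aux_unique hc h2 hfac hbf (hay ▸ hyf) hb ?_
      rintro rfl
      exact hne hay.symm
  · intro T hT
    have hmaps : Set.MapsTo T (Frames G q) (Frames G q) := fun f hf => (hT f hf).2.2
    have hfin : (Frames G q).Finite := by
      refine Set.Finite.subset (Set.Finite.pi' (fun _ : Fin (q + 1) =>
        (G.biUnion id).finite_toSet)) ?_
      intro f hf i
      simp only [Finset.mem_coe, Finset.mem_biUnion, id]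
      exact ⟨_, (Finset.mem_filter.1 hf.2).1, Finset.mem_image_of_mem f (Finset.mem_univ i)⟩
    have hinj : Set.InjOn T (Frames G q) := by
      intro f hf g hg hfg
      obtain ⟨hc, hzG, h0⟩ := aux_frame hq hG hf
      obtain ⟨hf1, hf2, hf3⟩ := hT f hf
      obtain ⟨hg1, hg2, hg3⟩ := hT g hg
      have hs : ∀ i : Fin q, g i.succ = f i.succ := by
        intro i
        rw [← hf1, ← hg1, hfg]
      have ff := hf.2
      have gf := hg.2
      have tf := hf3.2
      rw [aux_image] at ff gf
      rw [aux_image_last] at tf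
      simp only [hs] at gf
      simp only [hf1] at tf
      have e := aux_unique hc (hwall _ hzG hc) tf ff gf hf2.symm (by rw [hfg]; exact hg2.symm)
      funext i
      refine Fin.cases e (fun j => (hs j).symm) i
    exact ⟨hmaps, hinj, (Set.eq_of_subset_of_ncard_le hmaps.image_subset
      (Set.ncard_image_of_injOn hinj).ge hfin).ge⟩
end
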